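/- arXiv:1304.0226 — 2 statements merged into one kernel-verified Lean document; each statement's English description precedes it below -/
import Mathlib

section
/- Let R = End_K(U) and R' = End_{K'}(U') be endomorphism rings of finite-dimensional left vector spaces (dimensions ≥ 1) over (not necessarily commutative) fields, let 𝔐 and 𝔐' be the associated Grassmann spaces with point sets 𝒢 and 𝒢', and let Ψ: ℙ(R) → 𝒢 and Ψ': ℙ(R') → 𝒢' be the canonical bijections. For a mapping φ: ℙ(R) → ℙ(R'), the following are equivalent: (1) φ is a △-isomorphism; (2) φ is a ∼-isomorphism; (3) Ψ⁻¹ ∘ φ ∘ Ψ' (i.e. the map 𝒢 → 𝒢' given by X ↦ Ψ'(φ(Ψ⁻¹(X)))) is a collineation of 𝔐 onto 𝔐'. -/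
/-- `p` is a point of the projective line over `R`. -/
def IsPoint (R : Type*) [Ring R] (p : Submodule R (R × R)) : Prop :=
  ∃ g : (Matrix (Fin 2) (Fin 2) R)ˣ,
    p = Submodule.span R {(g.val 0 0, g.val 0 1)}

/-- distant relation -/
def Distant {R : Type*} [Ring R] (p q : Submodule R (R × R)) : Prop :=
  ∃ g : (Matrix (Fin 2) (Fin 2) R)ˣ,
    p = Submodule.span R {(g.val 0 0, g.val 0 1)} ∧
    q = Submodule.span R {(g.val 1 0, g.val 1 1)}

/-- `△(p)`: the set of points distant to `p`. -/
def DistantSet {R : Type*} [Ring R] (p : Submodule R (R × R)) :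
    Set (Submodule R (R × R)) := {x | Distant x p}

/-- `p ∥ q` iff `△(p) ⊆ △(q)`. -/
def Parallel {R : Type*} [Ring R] (p q : Submodule R (R × R)) : Prop :=
  DistantSet p ⊆ DistantSet q

/-- `p ∼ q` via `r`: `r ∦ p`, `r ∦ q` and `△(r) ⊆ △(p) ∪ △(q)`. -/
def AdjacentVia {R : Type*} [Ring R] (p q r : Submodule R (R × R)) : Prop :=
  ¬ Parallel r p ∧ ¬ Parallel r q ∧ DistantSet r ⊆ DistantSet p ∪ DistantSet q

/-- `p ∼ q`: there is a point `r` with `p ∼ q` via `r`. -/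
def Adjacent {R : Type*} [Ring R] (p q : Submodule R (R × R)) : Prop :=
  ∃ r, IsPoint R r ∧ AdjacentVia p q r

/-- `End_K(U)` with endomorphisms written on the right, as in the paper. -/
abbrev EndOp (K U : Type*) [DivisionRing K] [AddCommGroup U] [Module K U] :=
  (Module.End K U)ᵐᵒᵖ

/-- The projective line over `R` (as a type). -/
abbrev PL (R : Type*) [Ring R] := {p : Submodule R (R × R) // IsPoint R p}

/-- The point set `𝒢` of the Grassmann space of `n`-dimensional subspaces of `V`. -/
abbrev Grass (K V : Type*) [DivisionRing K] [AddCommGroup V] [Module K V] (n : ℕ) :=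
  {W : Submodule K V // Module.finrank K W = n}

/-- Lines (pencils) of the Grassmann space. -/
def IsGrassLine {K V : Type*} [DivisionRing K] [AddCommGroup V] [Module K V] {n : ℕ}
    (L : Set (Grass K V n)) : Prop :=
  ∃ M N : Submodule K V, Module.finrank K M = n - 1 ∧ Module.finrank K N = n + 1 ∧
    M < N ∧ L = {X | M < X.1 ∧ X.1 < N}

/-- A collineation between Grassmann spaces: a bijection of the point sets mapping lines
onto lines in both directions. -/
def IsGrassCollineation {K V K' V' : Type*} [DivisionRing K] [AddCommGroup V] [Module K V]
    [DivisionRing K'] [AddCommGroup V'] [Module K' V'] {n n' : ℕ}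
    (g : Grass K V n → Grass K' V' n') : Prop :=
  Function.Bijective g ∧ (∀ L, IsGrassLine L → IsGrassLine (g '' L)) ∧
    (∀ L', IsGrassLine L' → IsGrassLine (g ⁻¹' L'))

section GrassmannSpace

open Module Submodule

variable {K V : Type*} [DivisionRing K] [AddCommGroup V] [Module K V] {n : ℕ}

/-- Equality or adjacency in the Grassmann space. -/
def GrassNear (P Q : Grass K V n) : Prop :=
  finrank K ↥(P.1 ⊔ Q.1) ≤ n + 1

/-- The adjacency relation `∼`, expressed by means of complements. -/
def GrassAdjacent (P Q : Grass K V n) : Prop :=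
  ∃ R : Grass K V n, (∃ C : Grass K V n, IsCompl C.1 R.1 ∧ ¬ IsCompl C.1 P.1) ∧
    (∃ C : Grass K V n, IsCompl C.1 R.1 ∧ ¬ IsCompl C.1 Q.1) ∧
    ∀ C : Grass K V n, IsCompl C.1 R.1 → IsCompl C.1 P.1 ∨ IsCompl C.1 Q.1

theorem GrassNear.refl (P : Grass K V n) : GrassNear P P := by
  rw [GrassNear, sup_idem, P.2]
  exact n.le_succ

theorem GrassNear.symm {P Q : Grass K V n} (h : GrassNear P Q) : GrassNear Q P := by
  rwa [GrassNear, sup_comm]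

theorem GrassAdjacent.ne {P Q : Grass K V n} (h : GrassAdjacent P Q) : P ≠ Q := by
  rintro rfl
  obtain ⟨R, ⟨C, hCR, hCP⟩, -, h⟩ := h
  simpa [hCP] using h C hCR

theorem lt_and_lt_iff_le_and_le (hn : 1 ≤ n) {M N : Submodule K V} (hM : finrank K M = n - 1)
    (hN : finrank K N = n + 1) (X : Grass K V n) : M < X.1 ∧ X.1 < N ↔ M ≤ X.1 ∧ X.1 ≤ N := by
  have hX := X.2
  refine ⟨fun h => ⟨h.1.le, h.2.le⟩, fun h => ⟨h.1.lt_of_ne ?_, h.2.lt_of_ne ?_⟩⟩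
  · rintro rfl; omega
  · rintro rfl; omega

variable [FiniteDimensional K V]

theorem finrank_sup_span_singleton_of_notMem {M : Submodule K V} {x : V} (hx : x ∉ M) :
    finrank K ↥(M ⊔ span K {x}) = finrank K M + 1 := by
  have hx0 : x ≠ 0 := fun h => hx (h ▸ M.zero_mem)
  have h := finrank_sup_add_finrank_inf_eq M (span K {x})
  rw [((disjoint_span_singleton' hx0).2 hx).eq_bot, finrank_bot, finrank_span_singleton hx0] at h
  simpa using h

theorem exists_hyperplane_notMem {M N : Submodule K V} {x : V} (hMN : M ≤ N) (hxN : x ∈ N)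
    (hxM : x ∉ M) :
    ∃ H, M ≤ H ∧ H ≤ N ∧ x ∉ H ∧ finrank K H + 1 = finrank K N := by
  have hxle : span K {x} ≤ N := by simpa using hxN
  obtain ⟨H, hinf, hsup⟩ := IsModularLattice.exists_inf_eq_and_sup_eq
    (le_sup_left : M ≤ M ⊔ span K {x}) (sup_le hMN hxle)
  have hMH : M ≤ H := hinf ▸ inf_le_right
  have hHN : H ≤ N := hsup ▸ le_sup_right
  have hxH : x ∉ H := fun h =>
    hxM (hinf ▸ ⟨mem_sup_right (mem_span_singleton_self x), h⟩)
  refine ⟨H, hMH, hHN, hxH, ?_⟩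
  have hsup' : H ⊔ span K {x} = N := by
    rw [← hsup, sup_comm M, sup_assoc, sup_eq_right.2 hMH, sup_comm]
  rw [← finrank_sup_span_singleton_of_notMem hxH, hsup']

theorem finrank_sup_add_finrank_inf_grass (P Q : Grass K V n) :
    finrank K ↥(P.1 ⊔ Q.1) + finrank K ↥(P.1 ⊓ Q.1) = 2 * n := by
  rw [finrank_sup_add_finrank_inf_eq, P.2, Q.2, two_mul]

theorem grassNear_iff_le_finrank_inf {P Q : Grass K V n} :
    GrassNear P Q ↔ n ≤ finrank K ↥(P.1 ⊓ Q.1) + 1 := by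
  have := finrank_sup_add_finrank_inf_grass P Q
  unfold GrassNear
  omega

theorem Grass.eq_of_le {P Q : Grass K V n} (h : P.1 ≤ Q.1) : P = Q :=
  Subtype.ext (eq_of_le_of_finrank_eq h (P.2.trans Q.2.symm))

theorem Grass.exists_mem_notMem {P Q : Grass K V n} (h : P ≠ Q) : ∃ x ∈ P.1, x ∉ Q.1 :=
  SetLike.not_le_iff_exists.1 fun hle => h (Grass.eq_of_le hle)

theorem finrank_sup_of_grassNear {P Q : Grass K V n} (hne : P ≠ Q) (h : GrassNear P Q) :
    finrank K ↥(P.1 ⊔ Q.1) = n + 1 := by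
  obtain ⟨x, hxP, hxQ⟩ := Grass.exists_mem_notMem hne
  have hlt : Q.1 < P.1 ⊔ Q.1 :=
    lt_of_le_of_ne le_sup_right fun he => hxQ (he ▸ mem_sup_left hxP)
  have := finrank_lt_finrank_of_lt hlt
  have := Q.2
  unfold GrassNear at h
  omega

theorem isCompl_of_disjoint_grass (hV : finrank K V = 2 * n) {P Q : Grass K V n}
    (h : Disjoint P.1 Q.1) : IsCompl P.1 Q.1 :=
  (isCompl_iff_disjoint P.1 Q.1 (by rw [P.2, Q.2, hV]; omega)).2 h

theorem isCompl_grass_iff_finrank_sup (hV : finrank K V = 2 * n) {P Q : Grass K V n} :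
    IsCompl P.1 Q.1 ↔ finrank K ↥(P.1 ⊔ Q.1) = 2 * n := by
  refine ⟨fun h => by rw [h.sup_eq_top, finrank_top, hV], fun h => ?_⟩
  refine isCompl_of_disjoint_grass hV (disjoint_iff.2 (finrank_eq_zero.1 ?_))
  have := finrank_sup_add_finrank_inf_grass P Q
  omega

theorem exists_isCompl_grass (hV : finrank K V = 2 * n) (R : Grass K V n) {D : Submodule K V}
    (hD : Disjoint D R.1) : ∃ C : Grass K V n, D ≤ C.1 ∧ IsCompl C.1 R.1 := by
  obtain ⟨C, hDC, hC⟩ := hD.exists_isCompl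
  have := finrank_add_eq_of_isCompl hC
  have := R.2
  exact ⟨⟨C, by omega⟩, hDC, hC⟩

theorem exists_isCompl_not_isCompl (hV : finrank K V = 2 * n) {P R : Grass K V n} (h : P ≠ R) :
    ∃ C : Grass K V n, IsCompl C.1 R.1 ∧ ¬ IsCompl C.1 P.1 := by
  obtain ⟨x, hxP, hxR⟩ := Grass.exists_mem_notMem h
  have hx0 : x ≠ 0 := fun h => hxR (h ▸ zero_mem _)
  obtain ⟨C, hxC, hC⟩ := exists_isCompl_grass hV R ((disjoint_span_singleton' hx0).2 hxR).symm
  exact ⟨C, hC, fun h => hx0 (disjoint_def.1 h.disjoint x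
    (hxC (mem_span_singleton_self x)) hxP)⟩

theorem GrassAdjacent.near (hV : finrank K V = 2 * n) {P Q : Grass K V n}
    (h : GrassAdjacent P Q) : GrassNear P Q := by
  obtain ⟨R, ⟨C₁, hR₁, hP₁⟩, ⟨C₂, hR₂, hQ₂⟩, hR⟩ := h
  have hPR : P ≠ R := by rintro rfl; exact hP₁ hR₁
  have hQR : Q ≠ R := by rintro rfl; exact hQ₂ hR₂
  have key : ∀ p ∈ P.1, p ∉ R.1 → ∀ q ∈ Q.1, q ∉ R.1 → q ∈ R.1 ⊔ span K {p} := by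
    intro p hp hpR q hq hqR
    by_contra hcon
    have hp0 : p ≠ 0 := fun h => hpR (h ▸ zero_mem _)
    have hq0 : q ≠ 0 := fun h => hqR (h ▸ zero_mem _)
    have hdis : Disjoint (span K {q} ⊔ span K {p}) R.1 :=
      ((disjoint_span_singleton' hp0).2 hpR).symm.disjoint_sup_left_of_disjoint_sup_right
        (by rw [sup_comm]; exact ((disjoint_span_singleton' hq0).2 hcon).symm)
    obtain ⟨C, hDC, hC⟩ := exists_isCompl_grass hV R hdis
    rcases hR C hC with h | h
    · exact hp0 (disjoint_def.1 h.disjoint p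
        (hDC (mem_sup_right (mem_span_singleton_self p))) hp)
    · exact hq0 (disjoint_def.1 h.disjoint q
        (hDC (mem_sup_left (mem_span_singleton_self q))) hq)
  obtain ⟨p₀, hp₀, hp₀R⟩ := Grass.exists_mem_notMem hPR
  obtain ⟨q₀, hq₀, hq₀R⟩ := Grass.exists_mem_notMem hQR
  have hQ : Q.1 ≤ R.1 ⊔ span K {p₀} := fun q hq => by
    by_cases hqR : q ∈ R.1
    · exact mem_sup_left hqR
    · exact key p₀ hp₀ hp₀R q hq hqR
  have hP : P.1 ≤ R.1 ⊔ span K {p₀} := fun p hp => by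
    by_cases hpR : p ∈ R.1
    · exact mem_sup_left hpR
    have hle : ∀ p ∈ P.1, p ∉ R.1 → R.1 ⊔ span K {q₀} = R.1 ⊔ span K {p} := fun p hp hpR =>
      eq_of_le_of_finrank_eq
        (sup_le le_sup_left (by simpa using key p hp hpR q₀ hq₀ hq₀R))
        (by rw [finrank_sup_span_singleton_of_notMem hq₀R,
          finrank_sup_span_singleton_of_notMem hpR])
    rw [← hle p₀ hp₀ hp₀R, hle p hp hpR]
    exact mem_sup_right (mem_span_singleton_self p)
  have := finrank_mono (sup_le hP hQ)
  rwa [finrank_sup_span_singleton_of_notMem hp₀R, R.2] at this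

theorem GrassNear.adjacent (hV : finrank K V = 2 * n) {P Q : Grass K V n} (hne : P ≠ Q)
    (h : GrassNear P Q) : GrassAdjacent P Q := by
  obtain ⟨x, hxP, hxQ⟩ := Grass.exists_mem_notMem hne
  obtain ⟨y, hyQ, hyP⟩ := Grass.exists_mem_notMem hne.symm
  have hN := finrank_sup_of_grassNear hne h
  have hxyP : x + y ∉ P.1 := fun h => hyP ((add_mem_cancel_left hxP).1 h)
  have hxyQ : x + y ∉ Q.1 := fun h => hxQ ((add_mem_cancel_right hyQ).1 h)
  let R : Grass K V n := ⟨(P.1 ⊓ Q.1) ⊔ span K {x + y}, by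
    rw [finrank_sup_span_singleton_of_notMem fun h => hxyP (mem_inf.1 h).1]
    have := finrank_sup_add_finrank_inf_grass P Q
    omega⟩
  have hxyR : x + y ∈ R.1 := mem_sup_right (mem_span_singleton_self _)
  have hRN : R.1 ≤ P.1 ⊔ Q.1 := sup_le (inf_le_left.trans le_sup_left)
    (by simpa using add_mem_sup hxP hyQ)
  refine ⟨R, exists_isCompl_not_isCompl hV fun h => hxyP (h ▸ hxyR),
    exists_isCompl_not_isCompl hV fun h => hxyQ (h ▸ hxyR), fun C hC => ?_⟩
  by_contra! hcon
  have hnd : ∀ S : Grass K V n, ¬ IsCompl C.1 S.1 → ∃ z ∈ C.1, z ∈ S.1 ∧ z ≠ 0 := by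
    intro S hS
    have hdis : ¬ Disjoint C.1 S.1 := fun h => hS (isCompl_of_disjoint_grass hV h)
    rw [disjoint_def] at hdis
    push Not at hdis
    exact hdis
  obtain ⟨p, hpC, hpP, hp0⟩ := hnd P hcon.1
  obtain ⟨q, hqC, hqQ, hq0⟩ := hnd Q hcon.2
  have hpR : p ∉ R.1 := fun h => hp0 (disjoint_def.1 hC.disjoint p hpC h)
  have hspan : R.1 ⊔ span K {p} = P.1 ⊔ Q.1 :=
    eq_of_le_of_finrank_eq (sup_le hRN (by simpa using mem_sup_left hpP))
      (by rw [finrank_sup_span_singleton_of_notMem hpR, hN, R.2])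
  obtain ⟨r, hr, s, hs, hrs⟩ := mem_sup.1 (hspan.ge (mem_sup_right hqQ))
  obtain ⟨c, rfl⟩ := mem_span_singleton.1 hs
  have hrC : r ∈ C.1 := by
    rw [eq_sub_of_add_eq hrs]
    exact sub_mem hqC (smul_mem _ _ hpC)
  have hr0 : r = 0 := disjoint_def.1 hC.disjoint r hrC hr
  have hqP : q ∈ P.1 := by
    rw [← hrs, hr0, zero_add]
    exact smul_mem _ _ hpP
  exact hq0 (disjoint_def.1 hC.disjoint q hqC (mem_sup_left ⟨hqP, hqQ⟩))

theorem grassAdjacent_iff (hV : finrank K V = 2 * n) {P Q : Grass K V n} :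
    GrassAdjacent P Q ↔ P ≠ Q ∧ GrassNear P Q :=
  ⟨fun h => ⟨h.ne, h.near hV⟩, fun h => h.2.adjacent hV h.1⟩

theorem grassNear_iff (hV : finrank K V = 2 * n) {P Q : Grass K V n} :
    GrassNear P Q ↔ P = Q ∨ GrassAdjacent P Q := by
  rw [grassAdjacent_iff hV]
  refine ⟨fun h => (eq_or_ne P Q).imp_right fun hne => ⟨hne, h⟩, ?_⟩
  rintro (rfl | h)
  exacts [.refl P, h.2]

/-- `ReachIn A k x y` says that `y` is reached from `x` by `k` steps of the relation `A`. -/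
def ReachIn {α : Type*} (A : α → α → Prop) : ℕ → α → α → Prop
  | 0, x, y => x = y
  | k + 1, x, y => ∃ z, ReachIn A k x z ∧ A z y

theorem reachIn_congr {α β : Type*} {A : α → α → Prop} {B : β → β → Prop} (e : α ≃ β)
    (h : ∀ x y, A x y ↔ B (e x) (e y)) (k : ℕ) (x y : α) :
    ReachIn A k x y ↔ ReachIn B k (e x) (e y) := by
  induction k generalizing y with
  | zero => exact e.injective.eq_iff.symm
  | succ k ih => exact e.exists_congr fun z => and_congr (ih z) (h z y)

theorem reachIn_grassNear_iff {k : ℕ} {P Q : Grass K V n} :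
    ReachIn GrassNear k P Q ↔ finrank K ↥(P.1 ⊔ Q.1) ≤ n + k := by
  induction k generalizing Q with
  | zero =>
    refine ⟨?_, fun h => ?_⟩
    · rintro rfl
      rw [sup_idem, P.2, add_zero]
    · have h₁ := eq_of_le_of_finrank_le le_sup_left (h.trans_eq P.2.symm)
      exact (Grass.eq_of_le (sup_eq_left.1 h₁.symm)).symm
  | succ k ih =>
    constructor
    · rintro ⟨Z, hZ, hZQ⟩
      have h₁ := ih.1 hZ
      have h₂ := finrank_sup_add_finrank_inf_eq (P.1 ⊔ Z.1) (Z.1 ⊔ Q.1)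
      have h₃ : finrank K Z.1 ≤ finrank K ↥((P.1 ⊔ Z.1) ⊓ (Z.1 ⊔ Q.1)) :=
        finrank_mono (le_inf le_sup_right le_sup_left)
      have h₄ : finrank K ↥(P.1 ⊔ Q.1) ≤ finrank K ↥((P.1 ⊔ Z.1) ⊔ (Z.1 ⊔ Q.1)) :=
        finrank_mono (sup_le_sup le_sup_left le_sup_right)
      have := Z.2
      unfold GrassNear at hZQ
      omega
    · intro h
      rcases eq_or_ne P Q with rfl | hne
      · exact ⟨P, ih.2 (by rw [sup_idem, P.2]; omega), .refl P⟩
      obtain ⟨x, hxP, hxQ⟩ := Grass.exists_mem_notMem hne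
      obtain ⟨y, hyQ, hyP⟩ := Grass.exists_mem_notMem hne.symm
      obtain ⟨H, hinf, hHQ, hyH, hH⟩ := exists_hyperplane_notMem
        (inf_le_right : P.1 ⊓ Q.1 ≤ Q.1) hyQ fun h => hyP (mem_inf.1 h).1
      have hQ := Q.2
      have hP := P.2
      have hZ := finrank_sup_span_singleton_of_notMem fun h => hxQ (hHQ h)
      refine ⟨⟨H ⊔ span K {x}, by omega⟩, ih.2 ?_, ?_⟩
      · have hPx : span K {x} ≤ P.1 := by simpa using hxP
        have hsup : P.1 ⊔ (H ⊔ span K {x}) = P.1 ⊔ H := by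
          rw [sup_comm H, ← sup_assoc, sup_eq_left.2 hPx]
        change finrank K ↥(P.1 ⊔ (H ⊔ span K {x})) ≤ n + k
        rw [hsup]
        have h₁ := finrank_sup_add_finrank_inf_eq P.1 H
        have h₂ := finrank_sup_add_finrank_inf_grass P Q
        have h₃ := finrank_mono (le_inf inf_le_left hinf : P.1 ⊓ Q.1 ≤ P.1 ⊓ H)
        omega
      · rw [grassNear_iff_le_finrank_inf]
        have := finrank_mono (le_inf le_sup_left hHQ : H ≤ (H ⊔ span K {x}) ⊓ Q.1)
        change n ≤ finrank K ↥((H ⊔ span K {x}) ⊓ Q.1) + 1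
        omega

theorem isCompl_grass_iff_reachIn (hV : finrank K V = 2 * n) {P Q : Grass K V n} :
    IsCompl P.1 Q.1 ↔
      ∀ k, ReachIn GrassNear k P Q → ∀ X Y : Grass K V n, ReachIn GrassNear k X Y := by
  simp only [reachIn_grassNear_iff, isCompl_grass_iff_finrank_sup hV]
  have hle (X Y : Grass K V n) : finrank K ↥(X.1 ⊔ Y.1) ≤ 2 * n := hV ▸ finrank_le _
  refine ⟨fun h k hk X Y => (hle X Y).trans (h ▸ hk), fun h => (hle P Q).antisymm ?_⟩
  obtain ⟨C, -, hC⟩ := exists_isCompl_grass hV P disjoint_bot_left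
  rw [isCompl_grass_iff_finrank_sup hV] at hC
  have hP := P.2.symm.trans_le (finrank_mono (le_sup_left : P.1 ≤ P.1 ⊔ Q.1))
  have := h (finrank K ↥(P.1 ⊔ Q.1) - n) (by omega) C P
  omega

theorem finrank_inf_of_grassNear {X Y : Grass K V n} (hne : X ≠ Y) (h : GrassNear X Y) :
    finrank K ↥(X.1 ⊓ Y.1) = n - 1 := by
  have := finrank_sup_of_grassNear hne h
  have := finrank_sup_add_finrank_inf_grass X Y
  omega

theorem isGrassLine_iff_exists_near (hn : 1 ≤ n) {L : Set (Grass K V n)} :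
    IsGrassLine L ↔ ∃ X Y : Grass K V n, X ≠ Y ∧ GrassNear X Y ∧
      L = {Z | X.1 ⊓ Y.1 ≤ Z.1 ∧ Z.1 ≤ X.1 ⊔ Y.1} := by
  constructor
  · rintro ⟨M, N, hM, hN, hMN, rfl⟩
    simp only [lt_and_lt_iff_le_and_le hn hM hN]
    obtain ⟨x, hxN, hxM⟩ := SetLike.exists_of_lt hMN
    have hX := finrank_sup_span_singleton_of_notMem hxM
    have hXN : M ⊔ span K {x} ≤ N := sup_le hMN.le (by simpa using hxN)
    obtain ⟨y, hyN, hyX⟩ := SetLike.exists_of_lt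
      (hXN.lt_of_ne fun h => by rw [h] at hX; omega)
    have hyM : y ∉ M := fun h => hyX (mem_sup_left h)
    have hY := finrank_sup_span_singleton_of_notMem hyM
    have hYN : M ⊔ span K {y} ≤ N := sup_le hMN.le (by simpa using hyN)
    let X : Grass K V n := ⟨M ⊔ span K {x}, by omega⟩
    let Y : Grass K V n := ⟨M ⊔ span K {y}, by omega⟩
    have hne : X ≠ Y := fun h => hyX (by
      change y ∈ X.1
      rw [h]
      exact mem_sup_right (mem_span_singleton_self y))
    have hnear : GrassNear X Y := (finrank_mono (sup_le hXN hYN)).trans_eq hN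
    refine ⟨X, Y, hne, hnear, ?_⟩
    have hinf : M = X.1 ⊓ Y.1 := eq_of_le_of_finrank_eq (le_inf le_sup_left le_sup_left)
      (hM.trans (finrank_inf_of_grassNear hne hnear).symm)
    have hsup : X.1 ⊔ Y.1 = N := eq_of_le_of_finrank_eq (sup_le hXN hYN)
      ((finrank_sup_of_grassNear hne hnear).trans hN.symm)
    rw [← hinf, hsup]
  · rintro ⟨X, Y, hne, hnear, rfl⟩
    have hM := finrank_inf_of_grassNear hne hnear
    have hN := finrank_sup_of_grassNear hne hnear
    refine ⟨X.1 ⊓ Y.1, X.1 ⊔ Y.1, hM, hN, inf_le_sup.lt_of_ne fun h => ?_, ?_⟩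
    · rw [h] at hM; omega
    · simp only [lt_and_lt_iff_le_and_le hn hM hN]

theorem grassNear_iff_exists_isGrassLine (hn : 1 ≤ n) {X Y : Grass K V n} :
    GrassNear X Y ↔ X = Y ∨ ∃ L, IsGrassLine L ∧ X ∈ L ∧ Y ∈ L := by
  constructor
  · intro h
    refine (eq_or_ne X Y).imp_right fun hne => ⟨_, (isGrassLine_iff_exists_near hn).2
      ⟨X, Y, hne, h, rfl⟩, ⟨inf_le_left, le_sup_left⟩, inf_le_right, le_sup_right⟩
  · rintro (rfl | ⟨L, ⟨M, N, -, hN, -, rfl⟩, hX, hY⟩)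
    · exact .refl X
    · exact (finrank_mono (sup_le hX.2.le hY.2.le)).trans_eq hN

theorem inf_sup_eq_inf_of_grassNear {X Y Z : Grass K V n} (hne : X ≠ Y) (hXY : GrassNear X Y)
    (hZX : GrassNear Z X) (hZY : GrassNear Z Y) (hZ : ¬ Z.1 ≤ X.1 ⊔ Y.1) :
    Z.1 ⊓ (X.1 ⊔ Y.1) = X.1 ⊓ Y.1 := by
  have hlt := finrank_lt_finrank_of_lt (inf_le_left.lt_of_ne fun h => hZ (inf_eq_left.1 h) :
    Z.1 ⊓ (X.1 ⊔ Y.1) < Z.1)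
  have hn := Z.2
  have hM := finrank_inf_of_grassNear hne hXY
  have key : ∀ S : Grass K V n, GrassNear Z S → S.1 ≤ X.1 ⊔ Y.1 →
      Z.1 ⊓ (X.1 ⊔ Y.1) ≤ S.1 ∧ n ≤ finrank K ↥(Z.1 ⊓ (X.1 ⊔ Y.1)) + 1 := by
    intro S hZS hS
    rw [grassNear_iff_le_finrank_inf] at hZS
    have hle : Z.1 ⊓ S.1 ≤ Z.1 ⊓ (X.1 ⊔ Y.1) := inf_le_inf_left _ hS
    have := finrank_mono hle
    have heq := eq_of_le_of_finrank_le hle (by omega)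
    exact ⟨heq ▸ inf_le_right, by omega⟩
  obtain ⟨hX, hle⟩ := key X hZX le_sup_left
  obtain ⟨hY, -⟩ := key Y hZY le_sup_right
  exact eq_of_le_of_finrank_le (le_inf hX hY) (by omega)

theorem pencil_eq_setOf_near (hn : 1 ≤ n) (hV : finrank K V = 2 * n) {X Y : Grass K V n}
    (hne : X ≠ Y) (hXY : GrassNear X Y) :
    {Z : Grass K V n | X.1 ⊓ Y.1 ≤ Z.1 ∧ Z.1 ≤ X.1 ⊔ Y.1} =
      {Z | ∀ W, GrassNear W X → GrassNear W Y → GrassNear W Z} := by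
  have hM := finrank_inf_of_grassNear hne hXY
  have hN := finrank_sup_of_grassNear hne hXY
  have hMN : X.1 ⊓ Y.1 ≤ X.1 ⊔ Y.1 := inf_le_sup
  ext Z
  constructor
  · rintro ⟨hMZ, hZN⟩ W hWX hWY
    by_cases hW : W.1 ≤ X.1 ⊔ Y.1
    · exact (finrank_mono (sup_le hW hZN)).trans_eq hN
    · have hinf := inf_sup_eq_inf_of_grassNear hne hXY hWX hWY hW
      have := finrank_mono (le_inf (hinf ▸ inf_le_left) hMZ : X.1 ⊓ Y.1 ≤ W.1 ⊓ Z.1)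
      rw [grassNear_iff_le_finrank_inf]
      omega
  · intro h
    have hZX := (h X (.refl X) hXY).symm
    have hZY := (h Y hXY.symm (.refl Y)).symm
    have hZN : Z.1 ≤ X.1 ⊔ Y.1 := by
      by_contra hcon
      have hinf := inf_sup_eq_inf_of_grassNear hne hXY hZX hZY hcon
      have hM0 : X.1 ⊓ Y.1 ≠ ⊥ := fun hbot => hcon (by
        rw [hbot, finrank_bot] at hM
        rw [eq_top_of_finrank_eq (by omega : finrank K ↥(X.1 ⊔ Y.1) = finrank K V)]
        exact le_top)
      obtain ⟨m, hmM, hm0⟩ := exists_mem_ne_zero_of_ne_bot hM0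
      obtain ⟨W, -, hWN, hmW, hW⟩ := exists_hyperplane_notMem
        (bot_le : ⊥ ≤ X.1 ⊔ Y.1) (hMN hmM) (by simpa using hm0)
      have hnear := h ⟨W, by omega⟩ ((finrank_mono (sup_le hWN le_sup_left)).trans_eq hN)
        ((finrank_mono (sup_le hWN le_sup_right)).trans_eq hN)
      rw [grassNear_iff_le_finrank_inf] at hnear
      have hlt : W ⊓ Z.1 < X.1 ⊓ Y.1 := by
        refine SetLike.lt_iff_le_and_exists.2 ⟨?_, m, hmM, fun h => hmW (mem_inf.1 h).1⟩
        rw [← hinf]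
        exact le_inf inf_le_right (inf_le_left.trans hWN)
      have := finrank_lt_finrank_of_lt hlt
      change n ≤ finrank K ↥(W ⊓ Z.1) + 1 at hnear
      omega
    refine ⟨?_, hZN⟩
    by_contra hcon
    have hNtop : X.1 ⊔ Y.1 < ⊤ := lt_top_iff_ne_top.2 fun htop => hcon (by
      rw [htop, finrank_top] at hN
      rw [finrank_eq_zero.1 (by omega : finrank K ↥(X.1 ⊓ Y.1) = 0)]
      exact bot_le)
    obtain ⟨w, -, hwN⟩ := SetLike.exists_of_lt hNtop
    have hW := finrank_sup_span_singleton_of_notMem fun h => hwN (hMN h)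
    let W : Grass K V n := ⟨X.1 ⊓ Y.1 ⊔ span K {w}, by omega⟩
    have hMW : X.1 ⊓ Y.1 ≤ W.1 := le_sup_left
    have hWX : GrassNear W X := by
      rw [grassNear_iff_le_finrank_inf]
      have := finrank_mono (le_inf hMW inf_le_left)
      omega
    have hWY : GrassNear W Y := by
      rw [grassNear_iff_le_finrank_inf]
      have := finrank_mono (le_inf hMW inf_le_right)
      omega
    have hnear := h W hWX hWY
    have hinf := inf_sup_eq_inf_of_grassNear hne hXY hWX hWY
      fun h => hwN (h (mem_sup_right (mem_span_singleton_self w)))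
    rw [grassNear_iff_le_finrank_inf] at hnear
    have hle : W.1 ⊓ Z.1 ≤ X.1 ⊓ Y.1 := hinf ▸ inf_le_inf_left _ hZN
    have heq := eq_of_le_of_finrank_le hle (by omega)
    exact hcon (heq ▸ inf_le_right)

theorem isGrassLine_iff (hn : 1 ≤ n) (hV : finrank K V = 2 * n) {L : Set (Grass K V n)} :
    IsGrassLine L ↔ ∃ X Y : Grass K V n, X ≠ Y ∧ GrassNear X Y ∧
      L = {Z | ∀ W, GrassNear W X → GrassNear W Y → GrassNear W Z} := by
  rw [isGrassLine_iff_exists_near hn]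
  refine exists₂_congr fun X Y => and_congr_right fun hne => and_congr_right fun hXY => ?_
  rw [pencil_eq_setOf_near hn hV hne hXY]

end GrassmannSpace

section ProjectiveLine

open Module MulOpposite

variable {K U : Type*} [DivisionRing K] [AddCommGroup U] [Module K U]

/-- Endomorphisms of `U × U`, written on the right, as `2 × 2` matrices acting on row vectors. -/
def endProdEquivMatrix : (Module.End K (U × U))ᵐᵒᵖ ≃* Matrix (Fin 2) (Fin 2) (EndOp K U) where
  toFun F := !![op (LinearMap.fst K U U ∘ₗ F.unop ∘ₗ LinearMap.inl K U U),
      op (LinearMap.snd K U U ∘ₗ F.unop ∘ₗ LinearMap.inl K U U);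
    op (LinearMap.fst K U U ∘ₗ F.unop ∘ₗ LinearMap.inr K U U),
      op (LinearMap.snd K U U ∘ₗ F.unop ∘ₗ LinearMap.inr K U U)]
  invFun g := op (((g 0 0).unop.prod (g 0 1).unop).coprod ((g 1 0).unop.prod (g 1 1).unop))
  left_inv F := by
    apply unop_injective
    ext <;> simp
  right_inv g := by
    ext i j
    fin_cases i <;> fin_cases j <;> simp
  map_mul' F G := by
    have key (x : U × U) : G.unop x = G.unop (x.1, 0) + G.unop (0, x.2) := by
      rw [← map_add]; simp
    ext i j
    fin_cases i <;> fin_cases j <;> refine unop_injective (LinearMap.ext fun u => ?_) <;>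
      simp [Matrix.mul_apply, Fin.sum_univ_two] <;> rw [key (F.unop _)] <;> simp

theorem Distant.isPoint {R : Type*} [Ring R] {p q : Submodule R (R × R)} (h : Distant p q) :
    IsPoint R p :=
  h.imp fun _ hg => hg.1

variable [FiniteDimensional K U]

theorem finrank_prod_self : finrank K (U × U) = 2 * finrank K U := by
  rw [finrank_prod, two_mul]

theorem isUnit_matrix_iff_range_sup_eq_top (g : Matrix (Fin 2) (Fin 2) (EndOp K U)) :
    IsUnit g ↔ LinearMap.range ((g 0 0).unop.prod (g 0 1).unop) ⊔
      LinearMap.range ((g 1 0).unop.prod (g 1 1).unop) = ⊤ := by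
  rw [← LinearMap.range_coprod, ← LinearMap.isUnit_iff_range_eq_top]
  exact (MulEquiv.isUnit_map endProdEquivMatrix.symm).symm.trans isUnit_op

/-- The property characterising the canonical bijection `Ψ`. -/
def IsCanonical (Ψ : PL (EndOp K U) ≃ Grass K (U × U) (finrank K U)) : Prop :=
  ∀ (p : PL (EndOp K U)) (a b : Module.End K U),
    p.1 = Submodule.span (EndOp K U) {(op a, op b)} → (Ψ p).1 = LinearMap.range (a.prod b)

variable {Ψ : PL (EndOp K U) ≃ Grass K (U × U) (finrank K U)}

theorem IsCanonical.distant_iff (hΨ : IsCanonical Ψ) (p q : PL (EndOp K U)) :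
    Distant p.1 q.1 ↔ IsCompl (Ψ p).1 (Ψ q).1 := by
  constructor
  · rintro ⟨g, hp, hq⟩
    rw [isCompl_grass_iff_finrank_sup finrank_prod_self, hΨ p (g.val 0 0).unop (g.val 0 1).unop hp,
      hΨ q (g.val 1 0).unop (g.val 1 1).unop hq,
      (isUnit_matrix_iff_range_sup_eq_top g.val).1 g.isUnit, finrank_top, finrank_prod_self]
  · obtain ⟨g, hp⟩ := p.2
    obtain ⟨h, hq⟩ := q.2
    intro hpq
    have hsup := hpq.sup_eq_top
    rw [hΨ p (g.val 0 0).unop (g.val 0 1).unop hp,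
      hΨ q (h.val 0 0).unop (h.val 0 1).unop hq] at hsup
    obtain ⟨f, hf⟩ := (isUnit_matrix_iff_range_sup_eq_top
      !![g.val 0 0, g.val 0 1; h.val 0 0, h.val 0 1]).2 hsup
    exact ⟨f, by simpa [hf] using hp, by simpa [hf] using hq⟩

theorem IsCanonical.adjacent_iff (hΨ : IsCanonical Ψ) (p q : PL (EndOp K U)) :
    Adjacent p.1 q.1 ↔ GrassAdjacent (Ψ p) (Ψ q) := by
  have hpar (r s : PL (EndOp K U)) : ¬ Parallel r.1 s.1 ↔
      ∃ C : Grass K (U × U) (finrank K U), IsCompl C.1 (Ψ r).1 ∧ ¬ IsCompl C.1 (Ψ s).1 := by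
    rw [Parallel, Set.not_subset]
    constructor
    · rintro ⟨x, hxr, hxs⟩
      exact ⟨Ψ ⟨x, hxr.isPoint⟩, (hΨ.distant_iff _ r).1 hxr,
        fun h => hxs ((hΨ.distant_iff ⟨x, hxr.isPoint⟩ s).2 h)⟩
    · rintro ⟨C, hCr, hCs⟩
      obtain ⟨x, rfl⟩ := Ψ.surjective C
      exact ⟨x.1, (hΨ.distant_iff x r).2 hCr, fun h => hCs ((hΨ.distant_iff x s).1 h)⟩
  have hunion (r : PL (EndOp K U)) : DistantSet r.1 ⊆ DistantSet p.1 ∪ DistantSet q.1 ↔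
      ∀ C : Grass K (U × U) (finrank K U), IsCompl C.1 (Ψ r).1 →
        IsCompl C.1 (Ψ p).1 ∨ IsCompl C.1 (Ψ q).1 := by
    rw [Ψ.surjective.forall]
    simp only [← hΨ.distant_iff]
    exact ⟨fun h x hx => h hx, fun h x hx => h ⟨x, hx.isPoint⟩ hx⟩
  rw [GrassAdjacent, Ψ.surjective.exists]
  simp only [← hpar, ← hunion]
  exact ⟨fun ⟨r, hr, h⟩ => ⟨⟨r, hr⟩, h⟩, fun ⟨r, h⟩ => ⟨r.1, r.2, h⟩⟩

end ProjectiveLine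

section Isomorphisms

open Module

variable {K V K' V' : Type*} [DivisionRing K] [AddCommGroup V] [Module K V]
  [DivisionRing K'] [AddCommGroup V'] [Module K' V'] {n n' : ℕ}

theorem grassAdjacent_congr (e : Grass K V n ≃ Grass K' V' n')
    (h : ∀ P Q, IsCompl P.1 Q.1 ↔ IsCompl (e P).1 (e Q).1) (P Q : Grass K V n) :
    GrassAdjacent P Q ↔ GrassAdjacent (e P) (e Q) := by
  simp only [GrassAdjacent, e.surjective.exists, e.surjective.forall, ← h]

variable [FiniteDimensional K V] [FiniteDimensional K' V']

theorem forall_isCompl_iff_forall_grassNear (hV : finrank K V = 2 * n)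
    (hV' : finrank K' V' = 2 * n') (e : Grass K V n ≃ Grass K' V' n') :
    (∀ P Q, IsCompl P.1 Q.1 ↔ IsCompl (e P).1 (e Q).1) ↔
      ∀ P Q, GrassNear P Q ↔ GrassNear (e P) (e Q) := by
  refine ⟨fun h P Q => ?_, fun h P Q => ?_⟩
  · rw [grassNear_iff hV, grassNear_iff hV', e.injective.eq_iff, ← grassAdjacent_congr e h]
  · rw [isCompl_grass_iff_reachIn hV, isCompl_grass_iff_reachIn hV']
    simp only [e.surjective.forall, reachIn_congr e h]

theorem forall_grassAdjacent_iff_forall_grassNear (hV : finrank K V = 2 * n)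
    (hV' : finrank K' V' = 2 * n') (e : Grass K V n ≃ Grass K' V' n') :
    (∀ P Q, GrassAdjacent P Q ↔ GrassAdjacent (e P) (e Q)) ↔
      ∀ P Q, GrassNear P Q ↔ GrassNear (e P) (e Q) := by
  refine ⟨fun h P Q => ?_, fun h P Q => ?_⟩
  · rw [grassNear_iff hV, grassNear_iff hV', e.injective.eq_iff, h]
  · rw [grassAdjacent_iff hV, grassAdjacent_iff hV', e.injective.ne_iff, h]

theorem isGrassLine_image_iff (hn : 1 ≤ n) (hn' : 1 ≤ n') (hV : finrank K V = 2 * n)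
    (hV' : finrank K' V' = 2 * n') (e : Grass K V n ≃ Grass K' V' n')
    (h : ∀ P Q, GrassNear P Q ↔ GrassNear (e P) (e Q)) (L : Set (Grass K V n)) :
    IsGrassLine (e '' L) ↔ IsGrassLine L := by
  rw [isGrassLine_iff hn hV, isGrassLine_iff hn' hV', e.surjective.exists]
  refine exists_congr fun X => ?_
  rw [e.surjective.exists]
  refine exists_congr fun Y => ?_
  have himage : {Z | ∀ W, GrassNear W (e X) → GrassNear W (e Y) → GrassNear W Z} =
      e '' {Z | ∀ W, GrassNear W X → GrassNear W Y → GrassNear W Z} := by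
    ext Z
    obtain ⟨Z, rfl⟩ := e.surjective Z
    simp only [e.injective.mem_set_image, Set.mem_ofPred_eq, e.surjective.forall, ← h]
  rw [e.injective.ne_iff, ← h, himage, e.injective.image_injective.eq_iff]

theorem isGrassCollineation_iff_forall_grassNear (hn : 1 ≤ n) (hn' : 1 ≤ n')
    (hV : finrank K V = 2 * n) (hV' : finrank K' V' = 2 * n')
    (e : Grass K V n ≃ Grass K' V' n') :
    IsGrassCollineation e ↔ ∀ P Q, GrassNear P Q ↔ GrassNear (e P) (e Q) := by
  constructor
  · rintro ⟨-, himage, hpre⟩ P Q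
    rw [grassNear_iff_exists_isGrassLine hn, grassNear_iff_exists_isGrassLine hn',
      e.injective.eq_iff]
    refine or_congr_right ⟨?_, ?_⟩
    · rintro ⟨L, hL, hP, hQ⟩
      exact ⟨_, himage L hL, Set.mem_image_of_mem e hP, Set.mem_image_of_mem e hQ⟩
    · rintro ⟨L, hL, hP, hQ⟩
      exact ⟨_, hpre L hL, hP, hQ⟩
  · intro h
    have himage := isGrassLine_image_iff hn hn' hV hV' e h
    refine ⟨e.bijective, fun L => (himage L).2, fun L hL => (himage _).1 ?_⟩
    rwa [Set.image_preimage_eq L e.surjective]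

end Isomorphisms

/-- Let `R = End_K(U)`, `R' = End_{K'}(U')` (finite dimensions `≥ 1`), with
associated Grassmann spaces `𝔐`, `𝔐'` and canonical bijections `Ψ`, `Ψ'`.  For a mapping
`φ : ℙ(R) → ℙ(R')` the following are equivalent: (1) `φ` is a `△`-isomorphism;
(2) `φ` is a `∼`-isomorphism; (3) `Ψ⁻¹ ∘ φ ∘ Ψ'` is a collineation `𝔐 → 𝔐'`. -/
theorem stmt_8 {K U K' U' : Type*} [DivisionRing K] [AddCommGroup U] [Module K U]
    [FiniteDimensional K U] [DivisionRing K'] [AddCommGroup U'] [Module K' U']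
    [FiniteDimensional K' U']
    (hU : 1 ≤ Module.finrank K U) (hU' : 1 ≤ Module.finrank K' U')
    (Ψ : PL (EndOp K U) ≃ Grass K (U × U) (Module.finrank K U))
    (hΨ : ∀ (p : PL (EndOp K U)) (a b : Module.End K U),
      p.1 = Submodule.span (EndOp K U) {(MulOpposite.op a, MulOpposite.op b)} →
      (Ψ p).1 = LinearMap.range (a.prod b))
    (Ψ' : PL (EndOp K' U') ≃ Grass K' (U' × U') (Module.finrank K' U'))
    (hΨ' : ∀ (p' : PL (EndOp K' U')) (a b : Module.End K' U'),
      p'.1 = Submodule.span (EndOp K' U') {(MulOpposite.op a, MulOpposite.op b)} →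
      (Ψ' p').1 = LinearMap.range (a.prod b))
    (φ : PL (EndOp K U) → PL (EndOp K' U')) :
    ((Function.Bijective φ ∧
        ∀ p q : PL (EndOp K U), (Distant p.1 q.1 ↔ Distant (φ p).1 (φ q).1)) ↔
      (Function.Bijective φ ∧
        ∀ p q : PL (EndOp K U), (Adjacent p.1 q.1 ↔ Adjacent (φ p).1 (φ q).1))) ∧
    ((Function.Bijective φ ∧
        ∀ p q : PL (EndOp K U), (Distant p.1 q.1 ↔ Distant (φ p).1 (φ q).1)) ↔
      IsGrassCollineation (fun X => Ψ' (φ (Ψ.symm X)))) := by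
  have hV : Module.finrank K (U × U) = 2 * Module.finrank K U := finrank_prod_self
  have hV' : Module.finrank K' (U' × U') = 2 * Module.finrank K' U' := finrank_prod_self
  have hc : IsCanonical Ψ := hΨ
  have hc' : IsCanonical Ψ' := hΨ'
  have hcoll : IsGrassCollineation (fun X => Ψ' (φ (Ψ.symm X))) → Function.Bijective φ := by
    intro h
    have hφ : φ = Ψ'.symm ∘ (fun X => Ψ' (φ (Ψ.symm X))) ∘ Ψ := by
      ext1 p
      simp
    rw [hφ]
    exact Ψ'.symm.bijective.comp (h.1.comp Ψ.bijective)
  by_cases hφ : Function.Bijective φ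
  · obtain ⟨f, rfl⟩ : ∃ f : PL (EndOp K U) ≃ PL (EndOp K' U'), ⇑f = φ :=
      ⟨Equiv.ofBijective φ hφ, rfl⟩
    let e := (Ψ.symm.trans f).trans Ψ'
    have he (p : PL (EndOp K U)) : Ψ' (f p) = e (Ψ p) := by simp [e]
    have hdist : (∀ p q : PL (EndOp K U), Distant p.1 q.1 ↔ Distant (f p).1 (f q).1) ↔
        ∀ P Q, IsCompl P.1 Q.1 ↔ IsCompl (e P).1 (e Q).1 := by
      simp only [hc.distant_iff, hc'.distant_iff, he, Ψ.surjective.forall]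
    have hadj : (∀ p q : PL (EndOp K U), Adjacent p.1 q.1 ↔ Adjacent (f p).1 (f q).1) ↔
        ∀ P Q, GrassAdjacent P Q ↔ GrassAdjacent (e P) (e Q) := by
      simp only [hc.adjacent_iff, hc'.adjacent_iff, he, Ψ.surjective.forall]
    simp only [hφ, true_and]
    rw [hdist, hadj, forall_isCompl_iff_forall_grassNear hV hV',
      forall_grassAdjacent_iff_forall_grassNear hV hV']
    exact ⟨Iff.rfl, (isGrassCollineation_iff_forall_grassNear hU hU' hV hV' e).symm⟩
  · exact ⟨iff_of_false (fun h => hφ h.1) (fun h => hφ h.1),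
      iff_of_false (fun h => hφ h.1) (fun h => hφ (hcoll h))⟩
end

section
/- Let R = ∏_{i∈I} R_i be a direct product of rings over a non-empty index set I, with ℙ(R) identified componentwise with ∏_{i∈I} ℙ(R_i). Then for all p, q, r ∈ ℙ(R): p is adjacent to q via r if and only if there exists j ∈ I such that p_j is adjacent to q_j via r_j and for every i ∈ I with i ≠ j one has p_i ∥ q_i ∥ r_i. -/
/-- The `j`-th component projection `(Π R_i)² → (R j)²`, semilinear over evaluation. -/
def compMap {I : Type*} (R : I → Type*) [∀ i, Ring (R i)] (j : I) :
    ((Π i, R i) × (Π i, R i)) →ₛₗ[Pi.evalRingHom R j] (R j × R j) where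
  toFun x := (x.1 j, x.2 j)
  map_add' _ _ := rfl
  map_smul' _ _ := rfl

instance {I : Type*} (R : I → Type*) [∀ i, Ring (R i)] (j : I) :
    RingHomSurjective (Pi.evalRingHom R j) :=
  ⟨fun x => by classical exact ⟨Pi.single j x, Pi.single_eq_same j x⟩⟩

/-- The `j`-th component of a point of `ℙ(Π R_i)` under the canonical identification of
`ℙ(Π R_i)` with `Π ℙ(R_i)`: the image of `R(a,b)` is `R_j(a_j, b_j)`. -/
def component {I : Type*} {R : I → Type*} [∀ i, Ring (R i)]
    (p : Submodule (Π i, R i) ((Π i, R i) × (Π i, R i))) (j : I) :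
    Submodule (R j) (R j × R j) :=
  Submodule.map (compMap R j) p

section ProjectiveLine

variable {R : Type*} [Ring R]

theorem exists_unit_smul_row_of_span_eq {g h : (Matrix (Fin 2) (Fin 2) R)ˣ} {i j : Fin 2}
    (e : Submodule.span R {(g.val i 0, g.val i 1)} = Submodule.span R {(h.val j 0, h.val j 1)}) :
    ∃ u : Rˣ, ∀ k, h.val j k = u * g.val i k := by
  have right_inv (g : (Matrix (Fin 2) (Fin 2) R)ˣ) (i : Fin 2) :
      g.val i 0 * g⁻¹.val 0 i + g.val i 1 * g⁻¹.val 1 i = 1 := by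
    simpa [Matrix.mul_apply] using congrFun (congrFun g.mul_inv i) i
  obtain ⟨s, hs⟩ := Submodule.mem_span_singleton.1
    (e ▸ Submodule.mem_span_singleton_self (h.val j 0, h.val j 1) :
      (h.val j 0, h.val j 1) ∈ Submodule.span R {(g.val i 0, g.val i 1)})
  obtain ⟨t, ht⟩ := Submodule.mem_span_singleton.1
    (e ▸ Submodule.mem_span_singleton_self (g.val i 0, g.val i 1) :
      (g.val i 0, g.val i 1) ∈ Submodule.span R {(h.val j 0, h.val j 1)})
  simp only [Prod.smul_mk, smul_eq_mul, Prod.mk.injEq] at hs ht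
  have hts : t * s = 1 := by
    calc t * s = t * s * (g.val i 0 * g⁻¹.val 0 i + g.val i 1 * g⁻¹.val 1 i) := by
          rw [right_inv, mul_one]
      _ = t * (s * g.val i 0) * g⁻¹.val 0 i + t * (s * g.val i 1) * g⁻¹.val 1 i := by
          noncomm_ring
      _ = 1 := by rw [hs.1, hs.2, ht.1, ht.2, right_inv]
  have hst : s * t = 1 := by
    calc s * t = s * t * (h.val j 0 * h⁻¹.val 0 j + h.val j 1 * h⁻¹.val 1 j) := by
          rw [right_inv, mul_one]
      _ = s * (t * h.val j 0) * h⁻¹.val 0 j + s * (t * h.val j 1) * h⁻¹.val 1 j := by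
          noncomm_ring
      _ = 1 := by rw [ht.1, ht.2, hs.1, hs.2, right_inv]
  exact ⟨⟨s, t, hst, hts⟩, Fin.forall_fin_two.2 ⟨hs.1.symm, hs.2.symm⟩⟩

theorem distant_span_row_iff (g h : (Matrix (Fin 2) (Fin 2) R)ˣ) (i j : Fin 2) :
    Distant (Submodule.span R {(g.val i 0, g.val i 1)})
        (Submodule.span R {(h.val j 0, h.val j 1)}) ↔
      IsUnit !![g.val i 0, g.val i 1; h.val j 0, h.val j 1] := by
  constructor
  · rintro ⟨l, hg, hh⟩
    obtain ⟨u, hu⟩ := exists_unit_smul_row_of_span_eq hg.symm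
    obtain ⟨v, hv⟩ := exists_unit_smul_row_of_span_eq hh.symm
    have hd : IsUnit (!![u.val, 0; 0, v.val] : Matrix (Fin 2) (Fin 2) R) :=
      ⟨⟨_, !![u⁻¹.val, 0; 0, v⁻¹.val], by simp [Matrix.one_fin_two],
        by simp [Matrix.one_fin_two]⟩, rfl⟩
    convert hd.mul l.isUnit
    rw [Matrix.eta_fin_two l.val, Matrix.mul_fin_two]
    simp [hu, hv]
  · rintro ⟨l, hl⟩
    exact ⟨l, by simp [hl], by simp [hl]⟩

theorem IsPoint.exists_distant {p : Submodule R (R × R)} (hp : IsPoint R p) :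
    ∃ x, Distant x p := by
  obtain ⟨g, rfl⟩ := hp
  let s : (Matrix (Fin 2) (Fin 2) R)ˣ := ⟨!![0, 1; 1, 0], !![0, 1; 1, 0],
    by simp [Matrix.one_fin_two],
    by simp [Matrix.one_fin_two]⟩
  refine ⟨_, s * g, rfl, ?_⟩
  simp [s, Matrix.mul_apply]

theorem Distant.isPoint_left {p q : Submodule R (R × R)} (h : Distant p q) : IsPoint R p :=
  h.imp fun _ hg => hg.1

theorem isUnit_lowerUnitriangular (t : R) :
    IsUnit (!![1, 0; t, 1] : Matrix (Fin 2) (Fin 2) R) :=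
  ⟨⟨_, !![1, 0; -t, 1], by simp [Matrix.one_fin_two],
    by simp [Matrix.one_fin_two]⟩, rfl⟩

theorem isUnit_upperUnitriangular (t : R) :
    IsUnit (!![1, t; 0, 1] : Matrix (Fin 2) (Fin 2) R) :=
  ⟨⟨_, !![1, -t; 0, 1], by simp [Matrix.one_fin_two],
    by simp [Matrix.one_fin_two]⟩, rfl⟩

theorem isUnit_antitriangular {a c d : R} (ha : IsUnit a) (hd : IsUnit d) :
    IsUnit !![c, d; a, 0] := by
  obtain ⟨a, rfl⟩ := ha
  obtain ⟨d, rfl⟩ := hd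
  exact ⟨⟨_, !![0, a⁻¹.val; d⁻¹.val, -(d⁻¹.val * c * a⁻¹.val)],
    by simp [Matrix.one_fin_two, mul_assoc],
    by simp [Matrix.one_fin_two, mul_assoc]⟩, rfl⟩

theorem isUnit_bottom_of_antitriangular {a c d : R} (h : IsUnit !![c, d; a, 0])
    (hd : IsUnit d) : IsUnit a := by
  obtain ⟨d, rfl⟩ := hd
  obtain ⟨⟨_, N, h₁, h₂⟩, rfl⟩ := h
  rw [Matrix.eta_fin_two N, Matrix.mul_fin_two, Matrix.one_fin_two] at h₁ h₂
  simp at h₁ h₂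
  have h₀ : N 0 0 = 0 := by simpa using h₂.1.2
  have h₃ : N 0 1 * a = 1 := by simpa [h₀] using h₂.1.1
  exact ⟨⟨a, N 0 1, h₁.2.2, h₃⟩, rfl⟩

theorem isUnit_top_of_antitriangular {a c d : R} (h : IsUnit !![c, d; a, 0])
    (ha : IsUnit a) : IsUnit d := by
  obtain ⟨a, rfl⟩ := ha
  obtain ⟨⟨_, N, h₁, h₂⟩, rfl⟩ := h
  rw [Matrix.eta_fin_two N, Matrix.mul_fin_two, Matrix.one_fin_two] at h₁ h₂
  simp at h₁ h₂
  have h₀ : N 0 0 = 0 := by simpa using h₁.2.1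
  have h₃ : d * N 1 0 = 1 := by simpa [h₀] using h₁.1.1
  exact ⟨⟨d, N 1 0, h₃, h₂.2.2⟩, rfl⟩

theorem isUnit_one_add_mul_swap {b x : R} (h : IsUnit (1 + b * x)) : IsUnit (1 + x * b) := by
  obtain ⟨u, hu⟩ := h
  have h₁ : b * x = u - 1 := by rw [hu]; abel
  refine ⟨⟨1 + x * b, 1 - x * u⁻¹.val * b, ?_, ?_⟩, rfl⟩
  · calc (1 + x * b) * (1 - x * u⁻¹.val * b)
        = 1 + x * b - x * u⁻¹.val * b - x * (b * x) * u⁻¹.val * b := by noncomm_ring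
      _ = 1 + x * b - x * (u * u⁻¹.val) * b := by rw [h₁]; noncomm_ring
      _ = 1 := by simp
  · calc (1 - x * u⁻¹.val * b) * (1 + x * b)
        = 1 + x * b - x * u⁻¹.val * b - x * u⁻¹.val * (b * x) * b := by noncomm_ring
      _ = 1 + x * b - x * (u⁻¹.val * u) * b := by rw [h₁]; noncomm_ring
      _ = 1 := by simp

theorem isUnit_of_forall_isUnit {a b c d : R} (hK : IsUnit !![c, d; a, b])
    (h : ∀ x, IsUnit !![x, 1; a, b]) : IsUnit !![c, d; 1, 0] := by
  have hab (x : R) : IsUnit (a + b * x) := by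
    refine isUnit_bottom_of_antitriangular (c := -x) ?_ isUnit_one
    have := (isUnit_lowerUnitriangular (-b)).mul (h (-x))
    simpa [Matrix.mul_fin_two, add_comm] using this
  obtain ⟨u, hu⟩ : IsUnit a := by simpa using hab 0
  have hd : IsUnit (d - c * u⁻¹.val * b) := by
    refine isUnit_top_of_antitriangular (c := c) ?_ ⟨u, hu⟩
    have := hK.mul (isUnit_upperUnitriangular (-(u⁻¹.val * b)))
    simpa [Matrix.mul_fin_two, ← hu, ← mul_assoc, sub_eq_neg_add] using this
  obtain ⟨v, hv⟩ := hd
  have hx : IsUnit (1 + b * (v⁻¹.val * c * u⁻¹.val)) := by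
    have := (hab (v⁻¹.val * c)).mul u⁻¹.isUnit
    simpa [add_mul, ← hu, mul_assoc] using this
  have := v.isUnit.mul (isUnit_one_add_mul_swap hx)
  refine isUnit_antitriangular isUnit_one ?_
  convert this
  simp only [mul_add, mul_one, ← mul_assoc, Units.mul_inv, one_mul]
  rw [hv]
  abel

theorem Parallel.symm {p q : Submodule R (R × R)} (hp : IsPoint R p) (h : Parallel p q) :
    Parallel q p := by
  obtain ⟨g, rfl⟩ := hp
  rintro y ⟨k, rfl, rfl⟩
  have hK : k.val = (k * g⁻¹).val * g.val := by simp
  set K := (k * g⁻¹).val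
  have hunit : IsUnit K := (k * g⁻¹).isUnit
  have hrow (i j : Fin 2) : k.val i j = K i 0 * g.val 0 j + K i 1 * g.val 1 j := by
    conv_lhs => rw [hK]
    simp [Matrix.mul_apply]
  rw [Matrix.eta_fin_two K] at hunit
  have key : IsUnit !![K 0 0, K 0 1; 1, 0] := by
    refine isUnit_of_forall_isUnit hunit fun x => ?_
    obtain ⟨s, hs⟩ : IsUnit !![x, 1; (1 : R), 0] := isUnit_antitriangular isUnit_one isUnit_one
    have hd : Distant (Submodule.span R {((s * g).val 0 0, (s * g).val 0 1)})
        (Submodule.span R {(g.val 0 0, g.val 0 1)}) :=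
      ⟨s * g, rfl, by simp [hs, Matrix.mul_apply]⟩
    have hu := (distant_span_row_iff _ _ _ _).1 (h hd)
    convert hu.mul g⁻¹.isUnit
    rw [Units.eq_mul_inv_iff_mul_eq, Matrix.eta_fin_two g.val, Matrix.mul_fin_two]
    simp [hrow, hs, Matrix.mul_apply]
  obtain ⟨s, hs⟩ := key
  exact ⟨s * g, by simp [hs, hrow, Matrix.mul_apply], by simp [hs, Matrix.mul_apply]⟩

theorem Parallel.trans {p q r : Submodule R (R × R)} (h₁ : Parallel p q) (h₂ : Parallel q r) :
    Parallel p r :=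
  Set.Subset.trans h₁ h₂

end ProjectiveLine

section Product

variable {I : Type*} {R : I → Type*} [∀ i, Ring (R i)]

theorem component_span_singleton (a b : Π i, R i) (i : I) :
    component (Submodule.span (Π i, R i) {(a, b)}) i = Submodule.span (R i) {(a i, b i)} := by
  rw [component, Submodule.map_span, Set.image_singleton]
  rfl

theorem span_singleton_eq_of_component_eq {a b c d : Π i, R i}
    (h : ∀ i, Submodule.span (R i) {(a i, b i)} = Submodule.span (R i) {(c i, d i)}) :
    Submodule.span (Π i, R i) {(a, b)} = Submodule.span (Π i, R i) {(c, d)} := by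
  have le {a b c d : Π i, R i}
      (h : ∀ i, Submodule.span (R i) {(a i, b i)} = Submodule.span (R i) {(c i, d i)}) :
      Submodule.span (Π i, R i) {(a, b)} ≤ Submodule.span (Π i, R i) {(c, d)} := by
    have hm (i : I) : (a i, b i) ∈ Submodule.span (R i) {(c i, d i)} :=
      h i ▸ Submodule.mem_span_singleton_self _
    choose t ht using fun i => Submodule.mem_span_singleton.1 (hm i)
    rw [Submodule.span_singleton_le_iff_mem, Submodule.mem_span_singleton]
    exact ⟨t, Prod.ext (funext fun i => congrArg Prod.fst (ht i))
      (funext fun i => congrArg Prod.snd (ht i))⟩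
  exact le_antisymm (le h) (le fun i => (h i).symm)

/-- The invertible matrix over `Π i, R i` with prescribed components. -/
def piMatrixUnit (g : Π i, (Matrix (Fin 2) (Fin 2) (R i))ˣ) :
    (Matrix (Fin 2) (Fin 2) (Π i, R i))ˣ where
  val := Matrix.of fun a b i => (g i).val a b
  inv := Matrix.of fun a b i => (g i)⁻¹.val a b
  val_inv := by
    ext a b i
    have := congrFun (congrFun (g i).mul_inv a) b
    fin_cases a <;> fin_cases b <;> simpa [Matrix.mul_apply] using this
  inv_val := by
    ext a b i
    have := congrFun (congrFun (g i).inv_mul a) b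
    fin_cases a <;> fin_cases b <;> simpa [Matrix.mul_apply] using this

theorem evalMatrix_mul_eq_one {A B : Matrix (Fin 2) (Fin 2) (Π i, R i)} (h : A * B = 1) (i : I) :
    (Matrix.of fun a b => A a b i) * (Matrix.of fun a b => B a b i) = 1 := by
  ext a b
  have hab : (A * B) a b i = (1 : Matrix (Fin 2) (Fin 2) (Π i, R i)) a b i := by rw [h]
  fin_cases a <;> fin_cases b <;> simpa [Matrix.mul_apply] using hab

/-- The componentwise projection of an invertible matrix over `Π i, R i`. -/
def evalMatrixUnit (g : (Matrix (Fin 2) (Fin 2) (Π i, R i))ˣ) (i : I) :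
    (Matrix (Fin 2) (Fin 2) (R i))ˣ where
  val := Matrix.of fun a b => g.val a b i
  inv := Matrix.of fun a b => g.inv a b i
  val_inv := evalMatrix_mul_eq_one g.val_inv i
  inv_val := evalMatrix_mul_eq_one g.inv_val i

theorem Distant.map_component {p q : Submodule (Π i, R i) ((Π i, R i) × (Π i, R i))}
    (h : Distant p q) (i : I) : Distant (component p i) (component q i) := by
  obtain ⟨g, rfl, rfl⟩ := h
  exact ⟨evalMatrixUnit g i,
    component_span_singleton _ _ i, component_span_singleton _ _ i⟩

theorem IsPoint.map_component {p : Submodule (Π i, R i) ((Π i, R i) × (Π i, R i))}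
    (h : IsPoint (Π i, R i) p) (i : I) : IsPoint (R i) (component p i) := by
  obtain ⟨g, rfl⟩ := h
  exact ⟨evalMatrixUnit g i, component_span_singleton _ _ i⟩

theorem distant_iff_component {p q : Submodule (Π i, R i) ((Π i, R i) × (Π i, R i))}
    (hp : IsPoint (Π i, R i) p) (hq : IsPoint (Π i, R i) q) :
    Distant p q ↔ ∀ i, Distant (component p i) (component q i) := by
  refine ⟨Distant.map_component, fun h => ?_⟩
  obtain ⟨a, rfl⟩ := hp
  obtain ⟨b, rfl⟩ := hq
  simp only [component_span_singleton] at h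
  choose g hg using h
  exact ⟨piMatrixUnit g, span_singleton_eq_of_component_eq fun i => (hg i).1,
    span_singleton_eq_of_component_eq fun i => (hg i).2⟩

theorem exists_isPoint_component_eq {x : Π i, Submodule (R i) (R i × R i)}
    (hx : ∀ i, IsPoint (R i) (x i)) :
    ∃ y, IsPoint (Π i, R i) y ∧ ∀ i, component y i = x i := by
  choose g hg using hx
  exact ⟨_, ⟨piMatrixUnit g, rfl⟩, fun i => (component_span_singleton _ _ i).trans (hg i).symm⟩

/-- `△(r)` is the product of the `△(r_i)`. -/
theorem exists_distant_component_eq {r : Submodule (Π i, R i) ((Π i, R i) × (Π i, R i))}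
    (hr : IsPoint (Π i, R i) r) {x : Π i, Submodule (R i) (R i × R i)}
    (hx : ∀ i, Distant (x i) (component r i)) :
    ∃ y, Distant y r ∧ ∀ i, component y i = x i := by
  obtain ⟨y, hy, hyx⟩ := exists_isPoint_component_eq fun i => (hx i).isPoint_left
  exact ⟨y, (distant_iff_component hy hr).2 fun i => hyx i ▸ hx i, hyx⟩

theorem parallel_of_forall_component {p q : Submodule (Π i, R i) ((Π i, R i) × (Π i, R i))}
    (hq : IsPoint (Π i, R i) q) (h : ∀ i, Parallel (component p i) (component q i)) :
    Parallel p q :=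
  fun _ hx => (distant_iff_component hx.isPoint_left hq).2 fun i => h i (hx.map_component i)

theorem exists_distant_extending {r : Submodule (Π i, R i) ((Π i, R i) × (Π i, R i))}
    (hr : IsPoint (Π i, R i) r) (j : I) {x : Submodule (R j) (R j × R j)}
    (hx : Distant x (component r j)) : ∃ y, Distant y r ∧ component y j = x := by
  classical
  choose z hz using fun i => (hr.map_component i).exists_distant
  obtain ⟨y, hy, hyx⟩ := exists_distant_component_eq hr (x := Function.update z j x) fun i => by
    obtain rfl | hi := eq_or_ne i j
    · simpa using hx
    · simpa [hi] using hz i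
  exact ⟨y, hy, by simp [hyx]⟩

theorem Parallel.map_component {p q : Submodule (Π i, R i) ((Π i, R i) × (Π i, R i))}
    (hp : IsPoint (Π i, R i) p) (h : Parallel p q) (i : I) :
    Parallel (component p i) (component q i) := by
  intro x hx
  obtain ⟨y, hy, rfl⟩ := exists_distant_extending hp i hx
  exact Distant.map_component (h hy) i

/-- If `△(r) ⊆ △(p) ∪ △(q)`, then `r_i ∦ p_i` and `r_k ∦ q_k` cannot occur at different
indices. -/
theorem parallel_component_of_not_parallel
    {p q r : Submodule (Π i, R i) ((Π i, R i) × (Π i, R i))} (hr : IsPoint (Π i, R i) r)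
    (h : DistantSet r ⊆ DistantSet p ∪ DistantSet q) {j k : I} (hkj : k ≠ j)
    (hj : ¬ Parallel (component r j) (component p j)) :
    Parallel (component r k) (component q k) := by
  classical
  obtain ⟨x, (hxr : Distant x _), hxp⟩ := Set.not_subset.1 hj
  intro z (hz : Distant z _)
  choose w hw using fun i => (hr.map_component i).exists_distant
  obtain ⟨y, hy, hyx⟩ := exists_distant_component_eq hr
      (x := Function.update (Function.update w j x) k z) fun i => by
    obtain rfl | hi := eq_or_ne i k
    · simpa using hz
    obtain rfl | hi' := eq_or_ne i j
    · simpa [hi] using hxr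
    · simpa [hi, hi'] using hw i
  have hyj : component y j = x := by simp [hyx, hkj.symm]
  have hyk : component y k = z := by simp [hyx]
  rcases h hy with hp | hq
  · exact absurd (hyj ▸ Distant.map_component hp j) hxp
  · exact hyk ▸ Distant.map_component hq k

end Product

/-- For a direct product `R = Π_{i ∈ I} R_i` (`I` non-empty) and points
`p, q, r` of `ℙ(R)`: `p ∼ q` via `r` iff there is a `j ∈ I` with `p_j ∼ q_j` via `r_j` and
`p_i ∥ q_i ∥ r_i` for all `i ≠ j`. -/
theorem stmt_13 {I : Type*} [Nonempty I] {R : I → Type*} [∀ i, Ring (R i)]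
    (p q r : Submodule (Π i, R i) ((Π i, R i) × (Π i, R i)))
    (hp : IsPoint (Π i, R i) p) (hq : IsPoint (Π i, R i) q) (hr : IsPoint (Π i, R i) r) :
    AdjacentVia p q r ↔
      ∃ j, AdjacentVia (component p j) (component q j) (component r j) ∧
        ∀ i, i ≠ j → (Parallel (component p i) (component q i) ∧
          Parallel (component q i) (component r i)) := by
  constructor
  · rintro ⟨hrp, hrq, h⟩
    obtain ⟨j, hj⟩ : ∃ j, ¬ Parallel (component r j) (component p j) := by
      by_contra! hall
      exact hrp (parallel_of_forall_component hp hall)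
    have hq_of_ne (k : I) (hk : k ≠ j) : Parallel (component r k) (component q k) :=
      parallel_component_of_not_parallel hr h hk hj
    have hj' : ¬ Parallel (component r j) (component q j) := by
      intro hpar
      refine hrq (parallel_of_forall_component hq fun k => ?_)
      obtain rfl | hk := eq_or_ne k j
      exacts [hpar, hq_of_ne k hk]
    have hp_of_ne (k : I) (hk : k ≠ j) : Parallel (component r k) (component p k) :=
      parallel_component_of_not_parallel hr (Set.union_comm _ _ ▸ h) hk hj'
    refine ⟨j, ⟨hj, hj', fun x hx => ?_⟩, fun i hi => ⟨?_, ?_⟩⟩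
    · obtain ⟨y, hy, rfl⟩ := exists_distant_extending hr j hx
      exact (h hy).imp (fun h' => h'.map_component j) (fun h' => h'.map_component j)
    · exact ((hp_of_ne i hi).symm (hr.map_component i)).trans (hq_of_ne i hi)
    · exact (hq_of_ne i hi).symm (hr.map_component i)
  · rintro ⟨j, ⟨hrp, hrq, h⟩, hpar⟩
    refine ⟨fun h' => hrp (h'.map_component hr j), fun h' => hrq (h'.map_component hr j), fun x hx => ?_⟩
    have hrq_of_ne (i : I) (hi : i ≠ j) : Parallel (component r i) (component q i) :=
      (hpar i hi).2.symm (hq.map_component i)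
    have hrp_of_ne (i : I) (hi : i ≠ j) : Parallel (component r i) (component p i) :=
      (hrq_of_ne i hi).trans ((hpar i hi).1.symm (hp.map_component i))
    refine (h (hx.map_component j)).imp
      (fun hj => (distant_iff_component hx.isPoint_left hp).2 fun i => ?_)
      (fun hj => (distant_iff_component hx.isPoint_left hq).2 fun i => ?_)
    · obtain rfl | hi := eq_or_ne i j
      exacts [hj, hrp_of_ne i hi (hx.map_component i)]
    · obtain rfl | hi := eq_or_ne i j
      exacts [hj, hrq_of_ne i hi (hx.map_component i)]
end
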